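/- arXiv:1910.07651 — 3 statements merged into one kernel-verified Lean document; each statement's English description precedes it below -/
import Mathlib

section
/- Let A be a finite set of positive integers and let π be a partition in the bond lattice Π_{Γ_A} of the Ferrers graph Γ_A. Then (−1)^{|A| − b(π)} · μ(0̂, π) equals the number of D-permutations σ on A whose cycle support cyc(σ) equals π, where b(π) is the number of blocks of π, 0̂ is the partition of A into singletons, and μ is the Möbius function of Π_{Γ_A}. -/
open Finset

/-- The Ferrers graph on vertex set `V ⊆ ℕ`: edges `{u,v}` with `u < v`, `u` odd, `v` even. -/
def ferrers (V : Finset ℕ) : SimpleGraph ℕ :=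
  SimpleGraph.fromRel (fun u v => u ∈ V ∧ v ∈ V ∧ u < v ∧ Odd u ∧ Even v)

/-- A partition of `V` is a bond partition if each block induces a connected subgraph. -/
def IsBond (V : Finset ℕ) (P : Finpartition V) : Prop :=
  ∀ B ∈ P.parts, ((ferrers V).induce (B : Set ℕ)).Connected

/-- `u` is a (strict) descendant of `v` in the graph `G` rooted (componentwise) at `r`. -/
def DescOf {α : Type*} (G : SimpleGraph α) (r v u : α) : Prop :=
  u ≠ v ∧ G.Reachable u r ∧ ∀ p : G.Walk u r, v ∈ p.support

/-- `F` is an increasing-decreasing (ID) forest. -/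
def IsIDForest (V : Finset ℕ) (F : SimpleGraph {x // x ∈ V}) : Prop :=
  F.IsAcyclic ∧
  ∀ r v : {x // x ∈ V}, F.Reachable v r → (∀ u, F.Reachable v u → (u : ℕ) ≤ (r : ℕ)) →
    (Odd (v : ℕ) →
      (∀ u, DescOf F r v u → (v : ℕ) < (u : ℕ)) ∧
      (∀ u, F.Adj v u → DescOf F r v u → Even (u : ℕ))) ∧
    (Even (v : ℕ) →
      (∀ u, DescOf F r v u → (u : ℕ) < (v : ℕ)) ∧
      (∀ u, F.Adj v u → DescOf F r v u → Odd (u : ℕ)))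

/-- `T` is an increasing-decreasing (ID) tree. -/
def IsIDTree (V : Finset ℕ) (T : SimpleGraph {x // x ∈ V}) : Prop :=
  T.Connected ∧ IsIDForest V T

/-- A D-permutation on `A`. -/
def IsDPerm (A : Finset ℕ) (σ : Equiv.Perm {x // x ∈ A}) : Prop :=
  ∀ i : {x // x ∈ A}, (Odd (i : ℕ) → (i : ℕ) ≤ (σ i : ℕ)) ∧ (Even (i : ℕ) → (σ i : ℕ) ≤ (i : ℕ))

/-- A D-cycle on `A`: a D-permutation which is a single cycle covering `A`. -/
def IsDCycle (A : Finset ℕ) (σ : Equiv.Perm {x // x ∈ A}) : Prop :=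
  IsDPerm A σ ∧ ∀ x y : {x // x ∈ A}, σ.SameCycle x y

/-- The number of cycles (orbits, fixed points included) of a permutation. -/
noncomputable def cycleCount {α : Type*} (σ : Equiv.Perm α) : ℕ :=
  Nat.card (Quotient (⟨σ.SameCycle, Equiv.Perm.SameCycle.equivalence σ⟩ : Setoid α))

/-- A Dumont permutation on `A` (intended for `A = [2m]`). -/
def IsDumontPerm (A : Finset ℕ) (σ : Equiv.Perm {x // x ∈ A}) : Prop :=
  ∀ i : {x // x ∈ A}, (Even (i : ℕ) → (σ i : ℕ) < (i : ℕ)) ∧ (Odd (i : ℕ) → (i : ℕ) ≤ (σ i : ℕ))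

/-- A Dumont derangement on `A` (intended for `A = [2m]`). -/
def IsDumontDerangement (A : Finset ℕ) (σ : Equiv.Perm {x // x ∈ A}) : Prop :=
  ∀ i : {x // x ∈ A}, (Even (i : ℕ) → (σ i : ℕ) < (i : ℕ)) ∧ (Odd (i : ℕ) → (i : ℕ) < (σ i : ℕ))

/-- The Genocchi number `g n`: the number of Dumont permutations on `[2n-2]`. -/
noncomputable def genocchi (n : ℕ) : ℕ :=
  Nat.card {σ : Equiv.Perm {x // x ∈ Finset.Icc 1 (2 * n - 2)} // IsDumontPerm _ σ}

/-- The median Genocchi number `h n`: the number of Dumont derangements on `[2n+2]`. -/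
noncomputable def medianGenocchi (n : ℕ) : ℕ :=
  Nat.card {σ : Equiv.Perm {x // x ∈ Finset.Icc 1 (2 * n + 2)} // IsDumontDerangement _ σ}

open scoped Classical

section Perm

variable {α : Type*} [Fintype α] [DecidableEq α]

/-- The cycle of `σ` through `x`, as a finset (a singleton when `x` is fixed). -/
noncomputable def orbitFinset (σ : Equiv.Perm α) (x : α) : Finset α :=
  univ.filter (σ.SameCycle x)

lemma mem_orbitFinset {σ : Equiv.Perm α} {x y : α} :
    y ∈ orbitFinset σ x ↔ σ.SameCycle x y := by
  simp [orbitFinset]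

lemma orbitFinset_eq_support_cycleOf {σ : Equiv.Perm α} {x : α} (hx : x ∈ σ.support) :
    orbitFinset σ x = (σ.cycleOf x).support := by
  ext y
  rw [mem_orbitFinset, Equiv.Perm.mem_support_cycleOf_iff]
  exact ⟨fun h => ⟨h, hx⟩, fun h => h.1⟩

lemma orbitFinset_eq_singleton {σ : Equiv.Perm α} {x : α} (hx : x ∉ σ.support) :
    orbitFinset σ x = {x} := by
  have hfix : σ x = x := by simpa using hx
  ext y
  rw [mem_orbitFinset, mem_singleton]
  exact ⟨fun h => (h.eq_of_left hfix).symm, fun h => h ▸ Equiv.Perm.SameCycle.rfl⟩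

lemma image_orbitFinset_support (σ : Equiv.Perm α) :
    σ.support.image (orbitFinset σ) = σ.cycleFactorsFinset.image Equiv.Perm.support := by
  ext s
  simp only [mem_image]
  constructor
  · rintro ⟨x, hx, rfl⟩
    exact ⟨σ.cycleOf x, Equiv.Perm.cycleOf_mem_cycleFactorsFinset_iff.2 hx,
      (orbitFinset_eq_support_cycleOf hx).symm⟩
  · rintro ⟨c, hc, rfl⟩
    obtain ⟨x, hx⟩ := (Equiv.Perm.mem_cycleFactorsFinset_iff.1 hc).1.nonempty_support
    have hxσ := Equiv.Perm.mem_cycleFactorsFinset_support_le hc hx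
    refine ⟨x, hxσ, ?_⟩
    rw [orbitFinset_eq_support_cycleOf hxσ, ← Equiv.Perm.cycle_is_cycleOf hx hc]

lemma support_injOn_cycleFactorsFinset (σ : Equiv.Perm α) :
    Set.InjOn Equiv.Perm.support (σ.cycleFactorsFinset : Set (Equiv.Perm α)) := by
  intro c hc d hd h
  by_contra hne
  have hdisj := (σ.cycleFactorsFinset_pairwise_disjoint hc hd hne).disjoint_support
  obtain ⟨x, hx⟩ := (Equiv.Perm.mem_cycleFactorsFinset_iff.1 hc).1.nonempty_support
  exact Finset.disjoint_left.1 hdisj hx (h ▸ hx)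

lemma card_image_orbitFinset (σ : Equiv.Perm α) :
    (univ.image (orbitFinset σ)).card = σ.cycleFactorsFinset.card + σ.supportᶜ.card := by
  have hcompl : σ.supportᶜ.image (orbitFinset σ) = σ.supportᶜ.image singleton :=
    image_congr fun x hx => orbitFinset_eq_singleton (by simpa using hx)
  rw [← union_compl σ.support, image_union, card_union_of_disjoint, image_orbitFinset_support,
    hcompl, card_image_of_injOn (support_injOn_cycleFactorsFinset σ),
    card_image_of_injective _ (singleton_injective)]
  rw [hcompl, Finset.disjoint_left]
  simp only [mem_image, mem_compl]
  rintro _ ⟨x, hx, rfl⟩ ⟨y, hy, hxy⟩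
  have : x ∈ ({y} : Finset α) := hxy ▸ mem_orbitFinset.2 Equiv.Perm.SameCycle.rfl
  exact hy (mem_singleton.1 this ▸ hx)

lemma sign_eq_neg_one_pow_card_sub_orbits (σ : Equiv.Perm α) :
    ((Equiv.Perm.sign σ : ℤˣ) : ℤ) =
      (-1) ^ (Fintype.card α - (univ.image (orbitFinset σ)).card) := by
  have hc : Multiset.card σ.cycleType = σ.cycleFactorsFinset.card := by
    simp [Equiv.Perm.cycleType_def]
  have hle : Fintype.card α - (univ.image (orbitFinset σ)).card + 2 * σ.cycleFactorsFinset.card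
      = σ.support.card + σ.cycleFactorsFinset.card := by
    have h1 : (univ.image (orbitFinset σ)).card ≤ Fintype.card α := card_image_le
    have h2 := card_image_orbitFinset σ
    have h3 := card_add_card_compl σ.support
    omega
  rw [Equiv.Perm.sign_of_cycleType, Equiv.Perm.sum_cycleType, hc, ← hle, pow_add, pow_mul]
  simp

end Perm

section Partition

variable {A : Finset ℕ}

/-- The cycle support of a permutation of `A`: the partition of `A` into its orbits. -/
noncomputable def cycleSupport (σ : Equiv.Perm {x // x ∈ A}) : Finpartition A :=
  Finpartition.ofExistsUnique
    ((univ.image (orbitFinset σ)).map (mapEmbedding (Function.Embedding.subtype _)).toEmbedding)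
    (by
      simp only [mem_map, mem_image, mem_univ, true_and]
      rintro _ ⟨_, ⟨x, rfl⟩, rfl⟩ y hy
      obtain ⟨z, -, rfl⟩ := mem_map.1 hy
      exact z.2)
    (by
      intro a ha
      refine ⟨(orbitFinset σ ⟨a, ha⟩).map (Function.Embedding.subtype _), ⟨?_, ?_⟩, ?_⟩
      · exact mem_map_of_mem _ (mem_image_of_mem _ (mem_univ _))
      · exact mem_map.2 ⟨⟨a, ha⟩, mem_orbitFinset.2 Equiv.Perm.SameCycle.rfl, rfl⟩
      · simp only [mem_map, mem_image, mem_univ, true_and]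
        rintro _ ⟨⟨_, ⟨x, rfl⟩, rfl⟩, hax⟩
        obtain ⟨z, hz, rfl⟩ := mem_map.1 hax
        have hxz := mem_orbitFinset.1 hz
        change map _ _ = map _ _
        congr 1
        ext y
        rw [mem_orbitFinset, mem_orbitFinset]
        exact ⟨hxz.symm.trans, hxz.trans⟩)
    (by
      simp only [mem_map, mem_image, mem_univ, true_and]
      rintro ⟨_, ⟨x, rfl⟩, h⟩
      have : orbitFinset σ x = ∅ := map_eq_empty.1 h
      exact notMem_empty x (this ▸ mem_orbitFinset.2 Equiv.Perm.SameCycle.rfl))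

lemma mem_cycleSupport_parts {σ : Equiv.Perm {x // x ∈ A}} {B : Finset ℕ} :
    B ∈ (cycleSupport σ).parts ↔
      ∃ x, (orbitFinset σ x).map (Function.Embedding.subtype _) = B := by
  simp [cycleSupport, Finpartition.ofExistsUnique]

lemma mem_map_orbitFinset {σ : Equiv.Perm {x // x ∈ A}} {x y : {x // x ∈ A}} :
    (y : ℕ) ∈ (orbitFinset σ x).map (Function.Embedding.subtype _) ↔ σ.SameCycle x y := by
  rw [← mem_orbitFinset]
  exact mem_map' (Function.Embedding.subtype _)

lemma sign_eq_neg_one_pow_cycleSupport (σ : Equiv.Perm {x // x ∈ A}) :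
    ((Equiv.Perm.sign σ : ℤˣ) : ℤ) = (-1) ^ (A.card - (cycleSupport σ).parts.card) := by
  rw [sign_eq_neg_one_pow_card_sub_orbits]
  simp [cycleSupport, Finpartition.ofExistsUnique]

lemma Finpartition.le_iff_forall_part {P Q : Finpartition A} :
    P ≤ Q ↔ ∀ x y : {x // x ∈ A}, (∃ B ∈ P.parts, ↑x ∈ B ∧ ↑y ∈ B) →
      ∃ B ∈ Q.parts, ↑x ∈ B ∧ ↑y ∈ B := by
  constructor
  · rintro h x y ⟨B, hB, hx, hy⟩
    obtain ⟨C, hC, hBC⟩ := h hB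
    exact ⟨C, hC, hBC hx, hBC hy⟩
  · intro h B hB
    obtain ⟨x, hx⟩ := P.nonempty_of_mem_parts hB
    have hxA := P.subset hB hx
    refine ⟨Q.part x, Q.part_mem.2 hxA, fun y hy => ?_⟩
    obtain ⟨C, hC, hxC, hyC⟩ := h ⟨x, hxA⟩ ⟨y, P.subset hB hy⟩ ⟨B, hB, hx, hy⟩
    rwa [Q.part_eq_of_mem hC hxC]

lemma sameCycle_iff_cycleSupport (σ : Equiv.Perm {x // x ∈ A}) (x y : {x // x ∈ A}) :
    σ.SameCycle x y ↔ ∃ B ∈ (cycleSupport σ).parts, ↑x ∈ B ∧ ↑y ∈ B := by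
  constructor
  · intro h
    exact ⟨_, mem_cycleSupport_parts.2 ⟨x, rfl⟩,
      mem_map_orbitFinset.2 Equiv.Perm.SameCycle.rfl, mem_map_orbitFinset.2 h⟩
  · rintro ⟨B, hB, hx, hy⟩
    obtain ⟨z, rfl⟩ := mem_cycleSupport_parts.1 hB
    exact (mem_map_orbitFinset.1 hx).symm.trans (mem_map_orbitFinset.1 hy)

lemma cycleSupport_eq_iff {σ : Equiv.Perm {x // x ∈ A}} {P : Finpartition A} :
    cycleSupport σ = P ↔
      ∀ x y : {x // x ∈ A}, σ.SameCycle x y ↔ ∃ B ∈ P.parts, ↑x ∈ B ∧ ↑y ∈ B := by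
  constructor
  · rintro rfl
    exact sameCycle_iff_cycleSupport σ
  · intro h
    apply le_antisymm <;> rw [Finpartition.le_iff_forall_part] <;> intro x y hxy
    · exact (h x y).1 ((sameCycle_iff_cycleSupport σ x y).2 hxy)
    · exact (sameCycle_iff_cycleSupport σ x y).1 ((h x y).2 hxy)

lemma cycleSupport_le_iff {σ : Equiv.Perm {x // x ∈ A}} {P : Finpartition A} :
    cycleSupport σ ≤ P ↔ ∀ x : {x // x ∈ A}, (σ x : ℕ) ∈ P.part x := by
  rw [Finpartition.le_iff_forall_part]
  simp_rw [← sameCycle_iff_cycleSupport]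
  constructor
  · intro h x
    obtain ⟨B, hB, hx, hy⟩ := h x (σ x) (Equiv.Perm.sameCycle_apply_right.2 .rfl)
    rwa [P.part_eq_of_mem hB hx]
  · rintro h x _ hxy
    obtain ⟨n, rfl⟩ := hxy.exists_nat_pow_eq
    refine ⟨P.part x, P.part_mem.2 x.2, P.mem_part_self.2 x.2, ?_⟩
    induction n with
    | zero => exact P.mem_part_self.2 x.2
    | succ n ih =>
      have ih := ih ⟨n, by simp⟩
      have := h ((σ ^ n) x)
      rw [pow_succ', Equiv.Perm.mul_apply]
      rwa [P.part_eq_of_mem (P.part_mem.2 x.2) ih] at this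

end Partition

section Ferrers

variable {A : Finset ℕ}

lemma ferrers_adj_of_lt {u v : ℕ} (hu : u ∈ A) (hv : v ∈ A) (huv : u < v) (ho : Odd u)
    (he : Even v) : (ferrers A).Adj u v := by
  rw [ferrers, SimpleGraph.fromRel_adj]
  exact ⟨huv.ne, Or.inl ⟨hu, hv, huv, ho, he⟩⟩

lemma ferrers_adj_parity {u v : ℕ} (h : (ferrers A).Adj u v) :
    (u < v ∧ Odd u ∧ Even v) ∨ (v < u ∧ Odd v ∧ Even u) := by
  rw [ferrers, SimpleGraph.fromRel_adj] at h
  tauto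

lemma connected_induce_singleton (G : SimpleGraph ℕ) (a : ℕ) :
    (G.induce (({a} : Finset ℕ) : Set ℕ)).Connected := by
  have : Subsingleton ↥((({a} : Finset ℕ) : Set ℕ)) := by simp
  have : Nonempty ↥((({a} : Finset ℕ) : Set ℕ)) := ⟨⟨a, by simp⟩⟩
  exact { preconnected := .of_subsingleton }

lemma isBond_bot : IsBond A ⊥ := by
  intro B hB
  obtain ⟨a, -, rfl⟩ := Finpartition.mem_bot_iff.1 hB
  exact connected_induce_singleton _ _

/-- A block with odd minimum and even maximum induces a connected subgraph. -/
lemma connected_induce_ferrers {B : Finset ℕ} (hBA : B ⊆ A) {m M : ℕ} (hm : m ∈ B) (hM : M ∈ B)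
    (hmin : ∀ x ∈ B, m ≤ x) (hmax : ∀ x ∈ B, x ≤ M) (hmo : Odd m) (hMe : Even M) :
    ((ferrers A).induce (B : Set ℕ)).Connected := by
  have hadj : ∀ x ∈ B, ∀ y ∈ B, Odd x → Even y → x < y → (ferrers A).Adj x y :=
    fun x hx y hy ho he hxy => ferrers_adj_of_lt (hBA hx) (hBA hy) hxy ho he
  have hne : ∀ {x y : ℕ}, Odd x → Even y → x ≠ y := by
    rintro x _ hx hy rfl
    exact Nat.not_even_iff_odd.2 hx hy
  have hmM : ((ferrers A).induce (B : Set ℕ)).Adj ⟨m, hm⟩ ⟨M, hM⟩ :=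
    hadj m hm M hM hmo hMe (lt_of_le_of_ne (hmin M hM) (hne hmo hMe))
  rw [SimpleGraph.connected_iff_exists_forall_reachable]
  refine ⟨⟨m, hm⟩, fun ⟨x, hx⟩ => ?_⟩
  rcases Nat.even_or_odd x with he | ho
  · exact SimpleGraph.Adj.reachable (G := (ferrers A).induce (B : Set ℕ))
      (hadj m hm x hx hmo he (lt_of_le_of_ne (hmin x hx) (hne hmo he)))
  · have : ((ferrers A).induce (B : Set ℕ)).Adj ⟨x, hx⟩ ⟨M, hM⟩ :=
      hadj x hx M hM ho hMe (lt_of_le_of_ne (hmax x hx) (hne ho hMe))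
    exact hmM.reachable.trans this.symm.reachable

lemma odd_min_of_connected {B : Finset ℕ} (hB : ((ferrers A).induce (B : Set ℕ)).Connected)
    (hcard : 1 < B.card) {m : ℕ} (hm : m ∈ B) (hmin : ∀ x ∈ B, m ≤ x) : Odd m := by
  have : Nontrivial (B : Set ℕ) :=
    Set.nontrivial_coe_sort.2 (one_lt_card_iff_nontrivial.1 hcard)
  obtain ⟨⟨w, hw⟩, h⟩ := hB.preconnected.exists_adj_of_nontrivial ⟨m, hm⟩
  rcases ferrers_adj_parity h with h | h
  · exact h.2.1
  · exact absurd (hmin w hw) (not_le.2 h.1)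

lemma even_max_of_connected {B : Finset ℕ} (hB : ((ferrers A).induce (B : Set ℕ)).Connected)
    (hcard : 1 < B.card) {M : ℕ} (hM : M ∈ B) (hmax : ∀ x ∈ B, x ≤ M) : Even M := by
  have : Nontrivial (B : Set ℕ) :=
    Set.nontrivial_coe_sort.2 (one_lt_card_iff_nontrivial.1 hcard)
  obtain ⟨⟨w, hw⟩, h⟩ := hB.preconnected.exists_adj_of_nontrivial ⟨M, hM⟩
  rcases ferrers_adj_parity h with h | h
  · exact absurd (hmax w hw) (not_le.2 h.1)
  · exact h.2.2

lemma isBond_cycleSupport {σ : Equiv.Perm {x // x ∈ A}} (hσ : IsDPerm A σ) :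
    IsBond A (cycleSupport σ) := by
  intro B hB
  have hBA := (cycleSupport σ).subset hB
  have hne := (cycleSupport σ).nonempty_of_mem_parts hB
  obtain ⟨z, rfl⟩ := mem_cycleSupport_parts.1 hB
  set B := (orbitFinset σ z).map (Function.Embedding.subtype _) with hBdef
  by_cases hz : z ∈ σ.support
  swap
  · rw [hBdef, orbitFinset_eq_singleton hz, map_singleton]
    exact connected_induce_singleton _ _
  have hmoved : ∀ x : {x // x ∈ A}, (x : ℕ) ∈ B → (σ x : ℕ) ∈ B ∧ (σ x : ℕ) ≠ x := by
    intro x hx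
    have hzx := mem_map_orbitFinset.1 hx
    refine ⟨mem_map_orbitFinset.2 (Equiv.Perm.sameCycle_apply_right.2 hzx), fun h => ?_⟩
    exact (Equiv.Perm.mem_support.1 hz) (hzx.apply_eq_self_iff.2 (Subtype.ext h))
  have hmB := B.min'_mem hne
  have hMB := B.max'_mem hne
  refine connected_induce_ferrers hBA hmB hMB (fun x hx => B.min'_le x hx)
    (fun x hx => B.le_max' x hx) ?_ ?_
  · by_contra hodd
    have hm := hmoved ⟨_, hBA hmB⟩ hmB
    have hle := (hσ ⟨_, hBA hmB⟩).2 (Nat.not_odd_iff_even.1 hodd)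
    exact hm.2 (le_antisymm hle (B.min'_le _ hm.1))
  · by_contra heven
    have hM := hmoved ⟨_, hBA hMB⟩ hMB
    have hle := (hσ ⟨_, hBA hMB⟩).1 (Nat.not_even_iff_odd.1 heven)
    exact hM.2 (le_antisymm (B.le_max' _ hM.1) hle)

lemma Finpartition.exists_one_lt_card_of_ne_bot {P : Finpartition A} (hP : P ≠ ⊥) :
    ∃ B ∈ P.parts, 1 < B.card := by
  by_contra! h
  refine hP (le_bot_iff.1 fun B hB => ?_)
  obtain ⟨a, ha⟩ := P.nonempty_of_mem_parts hB
  refine ⟨{a}, Finpartition.mem_bot_iff.2 ⟨a, P.subset hB ha, rfl⟩, ?_⟩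
  exact fun b hb => mem_singleton.2 (card_le_one.1 (h B hB) b hb a ha)

/-- The sign-weighted count of D-permutations preserving the blocks of a bond partition is a
determinant, with two equal columns unless all blocks are singletons. -/
lemma sum_sign_cycleSupport_le {P : Finpartition A} (hP : IsBond A P) :
    ∑ σ ∈ univ.filter (fun σ : Equiv.Perm {x // x ∈ A} => IsDPerm A σ ∧ cycleSupport σ ≤ P),
      ((Equiv.Perm.sign σ : ℤˣ) : ℤ) = if ⊥ = P then 1 else 0 := by
  split_ifs with hbot
  · subst hbot
    have : univ.filter (fun σ : Equiv.Perm {x // x ∈ A} =>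
        IsDPerm A σ ∧ cycleSupport σ ≤ ⊥) = {1} := by
      ext σ
      simp only [mem_filter, mem_univ, true_and, mem_singleton, cycleSupport_le_iff]
      constructor
      · rintro ⟨-, h⟩
        ext x
        have hx : ({(x : ℕ)} : Finset ℕ) ∈ (⊥ : Finpartition A).parts :=
          Finpartition.mem_bot_iff.2 ⟨x, x.2, rfl⟩
        have := h x
        rw [Finpartition.part_eq_of_mem _ hx (mem_singleton_self _)] at this
        exact mem_singleton.1 this
      · rintro rfl
        exact ⟨fun i => ⟨fun _ => le_rfl, fun _ => le_rfl⟩,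
          fun x => Finpartition.mem_part_self _ |>.2 x.2⟩
    rw [this, sum_singleton, Equiv.Perm.sign_one, Units.val_one]
  · obtain ⟨B, hB, hcard⟩ := Finpartition.exists_one_lt_card_of_ne_bot (Ne.symm hbot)
    have hne := P.nonempty_of_mem_parts hB
    have hBA := P.subset hB
    have hmB := B.min'_mem hne
    have hMB := B.max'_mem hne
    have hmo := odd_min_of_connected (hP B hB) hcard hmB fun x hx => B.min'_le x hx
    have hMe := even_max_of_connected (hP B hB) hcard hMB fun x hx => B.le_max' x hx
    let D : Matrix {x // x ∈ A} {x // x ∈ A} ℤ := Matrix.of fun j i =>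
      if ((Odd (i : ℕ) → (i : ℕ) ≤ j) ∧ (Even (i : ℕ) → (j : ℕ) ≤ i)) ∧ (j : ℕ) ∈ P.part i
      then 1 else 0
    have hdet : D.det = 0 := by
      refine Matrix.det_zero_of_column_eq (i := ⟨_, hBA hmB⟩) (j := ⟨_, hBA hMB⟩) ?_ ?_
      · intro h
        rw [Subtype.mk.injEq] at h
        exact Nat.not_even_iff_odd.2 hmo (h ▸ hMe)
      · intro k
        simp only [D, Matrix.of_apply, P.part_eq_of_mem hB hmB, P.part_eq_of_mem hB hMB]
        refine if_congr (and_congr_left fun hk => ?_) rfl rfl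
        exact iff_of_true
          ⟨fun _ => B.min'_le _ hk, fun h => absurd h (Nat.not_even_iff_odd.2 hmo)⟩
          ⟨fun h => absurd hMe (Nat.not_even_iff_odd.2 h), fun _ => B.le_max' _ hk⟩
    rw [← hdet, Matrix.det_apply', sum_filter]
    refine sum_congr rfl fun σ _ => ?_
    simp only [D, Matrix.of_apply, Fintype.prod_boole, mul_ite, mul_one, mul_zero]
    refine if_congr ?_ rfl rfl
    rw [cycleSupport_le_iff, IsDPerm, ← forall_and]

end Ferrers

/-- For a partition `π` in the bond lattice of `Γ_A`, `(-1)^{|A|-b(π)} μ(0̂, π)` equals the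
number of D-permutations on `A` whose cycle support is `π`.  Here `μ` is any function
satisfying the defining recurrence of the Möbius function of the bond lattice (whose minimum
`⊥` is the partition into singletons). -/
theorem stmt8 (A : Finset ℕ) (hA : ∀ a ∈ A, 0 < a) (P : Finpartition A) (hP : IsBond A P)
    (μ : Finpartition A → Finpartition A → ℤ)
    (hμ : ∀ a b : Finpartition A, IsBond A a → IsBond A b → a ≤ b →
      (∑ c ∈ Finset.univ.filter fun c => IsBond A c ∧ a ≤ c ∧ c ≤ b, μ a c) =
        if a = b then 1 else 0) :
    (-1 : ℤ) ^ (A.card - P.parts.card) * μ ⊥ P =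
      Nat.card {σ : Equiv.Perm {x // x ∈ A} // IsDPerm A σ ∧
        ∀ x y : {x // x ∈ A}, σ.SameCycle x y ↔ ∃ B ∈ P.parts, ↑x ∈ B ∧ ↑y ∈ B} := by
  let f : Finpartition A → ℤ := fun c =>
    ∑ σ ∈ univ.filter (fun σ : Equiv.Perm {x // x ∈ A} => IsDPerm A σ ∧ cycleSupport σ = c),
      ((Equiv.Perm.sign σ : ℤˣ) : ℤ)
  have hsum : ∀ Q, IsBond A Q →
      ∑ c ∈ univ.filter (fun c => IsBond A c ∧ ⊥ ≤ c ∧ c ≤ Q), f c = if ⊥ = Q then 1 else 0 := by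
    intro Q hQ
    rw [← sum_sign_cycleSupport_le hQ, ← sum_fiberwise_of_maps_to
      (t := univ.filter (fun c => IsBond A c ∧ ⊥ ≤ c ∧ c ≤ Q)) (g := cycleSupport)]
    · refine sum_congr rfl fun c hc => ?_
      rw [filter_filter]
      refine sum_congr (filter_congr fun σ _ => ?_) fun _ _ => rfl
      have hcQ : c ≤ Q := (mem_filter.1 hc).2.2.2
      constructor
      · rintro ⟨h, rfl⟩
        exact ⟨⟨h, hcQ⟩, rfl⟩
      · rintro ⟨⟨h, -⟩, rfl⟩
        exact ⟨h, rfl⟩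
    · intro σ hσ
      have h := (mem_filter.1 hσ).2
      exact mem_filter.2 ⟨mem_univ _, isBond_cycleSupport h.1, bot_le, h.2⟩
  have hμf : ∀ Q, IsBond A Q → μ ⊥ Q = f Q := by
    intro Q
    induction Q using WellFoundedLT.induction with
    | ind Q ih =>
      intro hQ
      have h := (hμ ⊥ Q isBond_bot hQ bot_le).trans (hsum Q hQ).symm
      have hmem : Q ∈ univ.filter (fun c => IsBond A c ∧ ⊥ ≤ c ∧ c ≤ Q) :=
        mem_filter.2 ⟨mem_univ _, hQ, bot_le, le_rfl⟩
      rw [← add_sum_erase _ _ hmem, ← add_sum_erase _ _ hmem] at h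
      refine add_right_cancel (h.trans (congrArg _ (sum_congr rfl fun c hc => ?_)))
      obtain ⟨hne, hc⟩ := mem_erase.1 hc
      have hc := (mem_filter.1 hc).2
      exact (ih c (lt_of_le_of_ne hc.2.2 hne) hc.1).symm
  have hf : f P = (-1) ^ (A.card - P.parts.card) *
      ((univ.filter fun σ : Equiv.Perm {x // x ∈ A} =>
        IsDPerm A σ ∧ cycleSupport σ = P).card : ℤ) := by
    rw [mul_comm, ← nsmul_eq_mul, ← sum_const]
    refine sum_congr rfl fun σ hσ => ?_
    rw [sign_eq_neg_one_pow_cycleSupport, (mem_filter.1 hσ).2.2]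
  rw [hμf P hP, hf, ← mul_assoc, ← pow_add, Even.neg_one_pow ⟨_, rfl⟩, one_mul]
  simp_rw [← cycleSupport_eq_iff]
  rw [Nat.card_eq_fintype_card, Fintype.card_subtype]
end

section
/- Let A be a finite set of positive integers. For every nonnegative integer t, the number of proper colorings of the Ferrers graph Γ_A using colors from a fixed t-element set equals Σ_{σ ∈ D_A} (−1)^{|A| − c(σ)} t^{c(σ)}, where the sum is over all D-permutations σ on A and c(σ) is the number of cycles of σ (fixed points included). Equivalently, the chromatic polynomial of the Ferrers graph Γ_A is Σ_{k} (−1)^{|A|−k} d_k t^k, where d_k is the number of D-permutations on A with exactly k cycles. -/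
open Finset

namespace Equiv.Perm

variable {α : Type*} [Fintype α] [DecidableEq α]

theorem cycleCount_eq (σ : Perm α) :
    cycleCount σ = Fintype.card (Function.fixedPoints σ) + Multiset.card σ.cycleType := by
  let f : α → Function.fixedPoints σ ⊕ σ.cycleFactorsFinset := fun x =>
    if h : σ x = x then .inl ⟨x, h⟩
    else .inr ⟨σ.cycleOf x, cycleOf_mem_cycleFactorsFinset_iff.2 (mem_support.2 h)⟩
  have hf (x y : α) : f x = f y ↔ σ.SameCycle x y := by
    by_cases hx : σ x = x <;> by_cases hy : σ y = y
    · simp only [f, hx, hy, dite_true, Sum.inl.injEq]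
      refine ⟨fun h => ?_, fun h => Subtype.ext (h.eq_of_left hx)⟩
      obtain rfl : x = y := congrArg Subtype.val h
      rfl
    · simp only [f, hx, hy, dite_true, dite_false, reduceCtorEq, false_iff]
      exact fun h => hy (h.apply_eq_self_iff.1 hx)
    · simp only [f, hx, hy, dite_true, dite_false, reduceCtorEq, false_iff]
      exact fun h => hx (h.apply_eq_self_iff.2 hy)
    · simp only [f, hx, hy, dite_false, Sum.inr.injEq, Subtype.mk.injEq]
      exact (sameCycle_iff_cycleOf_eq_of_mem_support (mem_support.2 hx) (mem_support.2 hy)).symm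
  have hsurj : Function.Surjective f := by
    rintro (⟨x, hx⟩ | ⟨c, hc⟩)
    · exact ⟨x, dif_pos hx⟩
    · obtain ⟨x, hx⟩ := (mem_cycleFactorsFinset_iff.1 hc).1.nonempty_support
      have hσ : σ x ≠ x := mem_support.1 (mem_cycleFactorsFinset_support_le hc hx)
      exact ⟨x, by simp [f, hσ, cycle_is_cycleOf hx hc]⟩
  let s : Setoid α := ⟨σ.SameCycle, SameCycle.equivalence σ⟩
  have hbij : Function.Bijective (Quotient.lift (s := s) f fun x y h => (hf x y).2 h) := by
    refine ⟨?_, fun z => ?_⟩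
    · rintro ⟨x⟩ ⟨y⟩ h
      exact Quotient.sound ((hf x y).1 h)
    · obtain ⟨x, hx⟩ := hsurj z
      exact ⟨⟦x⟧, hx⟩
  have h := Nat.card_eq_of_bijective _ hbij
  rw [Nat.card_sum, Nat.card_eq_fintype_card (α := Function.fixedPoints σ),
    Nat.card_eq_fintype_card (α := σ.cycleFactorsFinset), Fintype.card_coe] at h
  simpa [cycleCount, cycleType_def] using h

theorem neg_one_pow_card_sub_cycleCount (σ : Perm α) :
    (-1 : ℤ) ^ (Fintype.card α - cycleCount σ) = sign σ := by
  have hle := σ.sum_cycleType_le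
  have hcard : Multiset.card σ.cycleType ≤ σ.cycleType.sum := by
    have := Multiset.card_nsmul_le_sum (s := σ.cycleType) (a := 1)
      fun n hn => (one_lt_of_mem_cycleType hn).le
    simpa using this
  have hc := σ.cycleCount_eq
  rw [card_fixedPoints] at hc
  rw [sign_of_cycleType,
    show σ.cycleType.sum + Multiset.card σ.cycleType
      = (Fintype.card α - cycleCount σ) + 2 * Multiset.card σ.cycleType by omega]
  simp [pow_add, pow_mul]

theorem card_invariant_fun (σ : Perm α) (β : Type*) [Fintype β] [DecidableEq β] :
    #{c : α → β | ∀ x, c (σ x) = c x} = Fintype.card β ^ cycleCount σ := by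
  let s : Setoid α := ⟨σ.SameCycle, SameCycle.equivalence σ⟩
  have hinv (c : α → β) (hc : ∀ x, c (σ x) = c x) (x y : α) (h : σ.SameCycle x y) :
      c x = c y := by
    obtain ⟨n, -, rfl⟩ := h.exists_pow_eq'
    induction n with
    | zero => rfl
    | succ n ih => rw [pow_succ', mul_apply, hc, ← ih ⟨n, by simp⟩]
  let e : {c : α → β // ∀ x, c (σ x) = c x} ≃ (Quotient s → β) :=
    { toFun := fun c => Quotient.lift c.1 (hinv c.1 c.2)
      invFun := fun d => ⟨fun x => d ⟦x⟧, fun x => congrArg d (Quotient.sound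
        (show σ.SameCycle (σ x) x from sameCycle_apply_left.2 SameCycle.rfl))⟩
      left_inv := fun c => rfl
      right_inv := fun d => by ext ⟨x⟩; rfl }
  have h := Nat.card_congr e
  rw [Nat.card_fun, Nat.card_eq_fintype_card, Fintype.card_subtype, Nat.card_eq_fintype_card] at h
  exact h

end Equiv.Perm

theorem Matrix.det_of_blockTriangular_injective {m R α : Type*} [CommRing R] [Fintype m]
    [DecidableEq m] [LinearOrder α] {M : Matrix m m R} {b : m → α} (hb : Function.Injective b)
    (h : M.BlockTriangular b) : M.det = ∏ i, M i i := by
  let : LinearOrder m := LinearOrder.lift' b hb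
  have := M.det_of_isUpperTriangular (fun i j hij => h hij)
  convert this

/-- The 0-1 matrix whose determinant is the signed count of the D-permutations on `A` that
preserve the coloring `c`. -/
def dPermMatrix {A : Finset ℕ} {β : Type*} [DecidableEq β] (c : {x // x ∈ A} → β) :
    Matrix {x // x ∈ A} {x // x ∈ A} ℤ :=
  .of fun j i => if c j = c i ∧ (Odd (i : ℕ) → (i : ℕ) ≤ j) ∧ (Even (i : ℕ) → (j : ℕ) ≤ i)
    then 1 else 0

section dPermMatrix

variable {A : Finset ℕ} {β : Type*} [DecidableEq β]

theorem ferrers_adj_iff {u v : ℕ} (hu : u ∈ A) (hv : v ∈ A) :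
    (ferrers A).Adj u v ↔ (u < v ∧ Odd u ∧ Even v) ∨ (v < u ∧ Odd v ∧ Even u) := by
  simp only [ferrers, SimpleGraph.fromRel_adj, hu, hv, true_and]
  constructor
  · exact And.right
  · rintro (h | h)
    · exact ⟨h.1.ne, .inl h⟩
    · exact ⟨h.1.ne', .inr h⟩

open scoped Classical in
theorem det_dPermMatrix_eq_sum (c : {x // x ∈ A} → β) :
    (dPermMatrix c).det = ∑ σ : Equiv.Perm {x // x ∈ A} with IsDPerm A σ,
      if ∀ x, c (σ x) = c x then (Equiv.Perm.sign σ : ℤ) else 0 := by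
  rw [Matrix.det_apply', Finset.sum_filter]
  refine Finset.sum_congr rfl fun σ _ => ?_
  simp only [dPermMatrix, Matrix.of_apply, Finset.prod_ite_zero, Finset.prod_const_one,
    Finset.mem_univ, true_imp_iff, forall_and, IsDPerm]
  split_ifs <;> simp_all

theorem det_dPermMatrix_of_proper (c : {x // x ∈ A} → β)
    (hc : ∀ u v : {x // x ∈ A}, (ferrers A).Adj ↑u ↑v → c u ≠ c v) :
    (dPermMatrix c).det = 1 := by
  let b : {x // x ∈ A} → ℤ := fun x => if Odd (x : ℕ) then -(x : ℕ) else (x : ℕ)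
  have hb : Function.Injective b := by
    intro x y h
    apply Subtype.ext
    simp only [b] at h
    grind
  rw [Matrix.det_of_blockTriangular_injective hb]
  · exact Finset.prod_eq_one fun i _ => by simp [dPermMatrix]
  · intro j i hij
    simp only [dPermMatrix, Matrix.of_apply, ite_eq_right_iff, one_ne_zero, imp_false]
    rintro ⟨hcol, ho, he⟩
    have h := hc j i
    rw [ferrers_adj_iff j.2 i.2] at h
    simp only [b] at hij
    grind

theorem det_dPermMatrix_of_not_proper (c : {x // x ∈ A} → β)
    (hc : ¬ ∀ u v : {x // x ∈ A}, (ferrers A).Adj ↑u ↑v → c u ≠ c v) :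
    (dPermMatrix c).det = 0 := by
  have hex : ∃ d : ℕ, ∃ u v : {x // x ∈ A},
      (u : ℕ) + d = v ∧ u < v ∧ Odd (u : ℕ) ∧ Even (v : ℕ) ∧ c u = c v := by
    push Not at hc
    obtain ⟨u, v, huv, h⟩ := hc
    obtain h' | h' := (ferrers_adj_iff u.2 v.2).1 huv
    · exact ⟨v - u, u, v, by omega, h'.1, h'.2.1, h'.2.2, h⟩
    · exact ⟨u - v, v, u, by omega, h'.1, h'.2.1, h'.2.2, h.symm⟩
  classical
  obtain ⟨u, v, hd, huv, hu, hv, h⟩ := Nat.find_spec hex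
  have hmin (u' v' : {x // x ∈ A}) (huv' : u' < v') (hu' : Odd (u' : ℕ)) (hv' : Even (v' : ℕ))
      (h' : c u' = c v') : (v : ℕ) - u ≤ v' - u' := by
    have := Nat.find_min' hex ⟨u', v', Nat.add_sub_of_le (Subtype.coe_le_coe.2 huv'.le),
      huv', hu', hv', h'⟩
    omega
  have huv_nat : (u : ℕ) < v := huv
  refine Matrix.det_zero_of_row_eq huv.ne (funext fun i => ?_)
  simp only [dPermMatrix, Matrix.of_apply, ← h]
  refine if_congr (and_congr_right fun hi => ?_) rfl rfl
  rcases Nat.even_or_odd (i : ℕ) with he | ho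
  · have hno : ¬ Odd (i : ℕ) := Nat.not_odd_iff_even.2 he
    simp only [hno, he, false_imp_iff, true_imp_iff, true_and]
    refine ⟨fun hle => ?_, fun hle => huv_nat.le.trans hle⟩
    have hne : (u : ℕ) ≠ i := fun h => hno (h ▸ hu)
    have hlt : (u : ℕ) < i := lt_of_le_of_ne hle hne
    have := hmin u i hlt hu he hi
    omega
  · have hne : ¬ Even (i : ℕ) := Nat.not_even_iff_odd.2 ho
    simp only [hne, ho, false_imp_iff, true_imp_iff, and_true]
    refine ⟨fun hle => hle.trans huv_nat.le, fun hle => ?_⟩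
    have hne : (i : ℕ) ≠ v := fun h => hne (h ▸ hv)
    have hlt : (i : ℕ) < v := lt_of_le_of_ne hle hne
    have := hmin i v hlt ho hv (hi.symm.trans h)
    omega

end dPermMatrix

open scoped Classical

/-- For every `t`, the number of proper colorings of the Ferrers graph `Γ_A` with colors in a
`t`-element set equals `Σ_{σ ∈ D_A} (-1)^{|A| - c(σ)} t^{c(σ)}`, the sum being over all
D-permutations on `A`. -/
theorem stmt9 (A : Finset ℕ) (hA : ∀ a ∈ A, 0 < a) (t : ℕ) :
    (Nat.card {c : {x // x ∈ A} → Fin t //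
        ∀ u v : {x // x ∈ A}, (ferrers A).Adj ↑u ↑v → c u ≠ c v} : ℤ) =
      ∑ σ ∈ Finset.univ.filter fun σ : Equiv.Perm {x // x ∈ A} => IsDPerm A σ,
        (-1 : ℤ) ^ (A.card - cycleCount σ) * (t : ℤ) ^ cycleCount σ := by
  have hterm (σ : Equiv.Perm {x // x ∈ A}) :
      (-1 : ℤ) ^ (A.card - cycleCount σ) * (t : ℤ) ^ cycleCount σ =
        ∑ c : {x // x ∈ A} → Fin t, if ∀ x, c (σ x) = c x then (Equiv.Perm.sign σ : ℤ) else 0 := by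
    have hsign := σ.neg_one_pow_card_sub_cycleCount
    have hinv := σ.card_invariant_fun (Fin t)
    rw [Fintype.card_coe] at hsign
    rw [Fintype.card_fin] at hinv
    rw [hsign, ← Finset.sum_filter, Finset.sum_const, nsmul_eq_mul, mul_comm, ← Nat.cast_pow,
      ← hinv]
  simp_rw [hterm]
  rw [Finset.sum_comm, Nat.card_eq_fintype_card, Fintype.card_subtype, Finset.natCast_card_filter]
  refine Finset.sum_congr rfl fun c _ => ?_
  have hdet := det_dPermMatrix_eq_sum c
  split_ifs with hc
  · rw [det_dPermMatrix_of_proper c hc] at hdet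
    convert hdet
  · rw [det_dPermMatrix_of_not_proper c hc] at hdet
    convert hdet
end

section
/- For all n ≥ 1, the characteristic polynomial of the bond lattice Π_{Γ_{2n}} satisfies χ_{2n}(t) = (t−1) · Σ_{σ ∈ D_{2n−2}} (−t)^{e(σ)} (1−t)^{o(σ)} as polynomials in t, where the sum is over all D-permutations σ on [2n−2], e(σ) is the number of fixed points of σ at even integers, and o(σ) is the number of cycles of σ that are not fixed points at even integers. (For n = 1 the sum is over the unique permutation of the empty set and equals 1.) -/
open Finset

open scoped Classical

/-- The number of fixed points of `σ` at even integers. -/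
noncomputable def evenFixCount {A : Finset ℕ} (σ : Equiv.Perm {x // x ∈ A}) : ℕ :=
  (Finset.univ.filter fun i : {x // x ∈ A} => σ i = i ∧ Even (i : ℕ)).card

/-- The number of fixed points of `σ`. -/
noncomputable def fixCount {A : Finset ℕ} (σ : Equiv.Perm {x // x ∈ A}) : ℕ :=
  (Finset.univ.filter fun i : {x // x ∈ A} => σ i = i).card


namespace Equiv.Perm

lemma SameCycle.map_of_step {X Y : Type*} {σ : Perm X} {τ : Perm Y} (f : X → Y)
    (hf : ∀ x, τ.SameCycle (f (σ x)) (f x)) {x y : X} (h : σ.SameCycle x y) :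
    τ.SameCycle (f x) (f y) := by
  obtain ⟨i, rfl⟩ := h
  induction i with
  | zero => simpa using SameCycle.refl τ (f x)
  | succ n ih =>
    rw [add_comm, zpow_add, zpow_one, mul_apply]
    exact ih.trans (hf _).symm
  | pred n ih =>
    refine ih.trans ?_
    have := hf ((σ ^ (-(n : ℤ) - 1)) x)
    rwa [← mul_apply, ← zpow_one_add, add_sub_cancel] at this

end Equiv.Perm

section CycleCount

open Equiv Equiv.Perm

variable {X Y : Type*}

lemma cycleCount_eq_of_maps {σ : Perm X} {τ : Perm Y} (f : X → Y) (g : Y → X)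
    (hf : ∀ x, τ.SameCycle (f (σ x)) (f x)) (hg : ∀ y, σ.SameCycle (g (τ y)) (g y))
    (hgf : ∀ x, σ.SameCycle (g (f x)) x) (hfg : ∀ y, τ.SameCycle (f (g y)) y) :
    cycleCount σ = cycleCount τ := by
  refine Nat.card_congr
    { toFun := Quotient.map f fun _ _ h => SameCycle.map_of_step f hf h
      invFun := Quotient.map g fun _ _ h => SameCycle.map_of_step g hg h
      left_inv := ?_
      right_inv := ?_ }
  · rintro ⟨x⟩
    exact Quotient.sound (hgf x)
  · rintro ⟨y⟩
    exact Quotient.sound (hfg y)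

lemma cycleCount_permCongr (e : X ≃ Y) (σ : Perm X) :
    cycleCount (e.permCongr σ) = cycleCount σ := by
  refine cycleCount_eq_of_maps e.symm e ?_ ?_ ?_ ?_ <;> intro x
  · simp [SameCycle.refl]
  · rw [← show e.permCongr σ (e x) = e (σ x) by simp]
    exact sameCycle_apply_left.2 (SameCycle.refl _ _)
  · simp [SameCycle.refl]
  · simp [SameCycle.refl]

lemma cycleCount_swap_mul_optionCongr [DecidableEq X] (j : X) (τ : Perm X) :
    cycleCount (swap none (some j) * τ.optionCongr) = cycleCount τ := by
  set σ := swap none (some j) * τ.optionCongr with hσ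
  have h0 : σ none = some j := by simp [hσ]
  have h1 : ∀ a, σ (some a) = if τ a = j then none else some (τ a) := by
    intro a
    split_ifs with h
    · simp [hσ, h]
    · simp only [hσ, mul_apply, optionCongr_apply, Option.map_some]
      exact swap_apply_of_ne_of_ne (by simp) (by simpa using h)
  refine cycleCount_eq_of_maps (fun x => x.getD j) some ?_ ?_ ?_ ?_
  · rintro (_ | a)
    · simp [h0, SameCycle.refl]
    · rw [h1]
      split_ifs with h
      · simp [← h, SameCycle.refl]
      · simp [SameCycle.refl]
  · intro a
    by_cases h : τ a = j
    · have h2 : σ (σ (some a)) = some (τ a) := by rw [h1, if_pos h, h0, h]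
      rw [← h2]
      simp [SameCycle.refl]
    · have h2 : σ (some a) = some (τ a) := by rw [h1, if_neg h]
      rw [← h2]
      simp [SameCycle.refl]
  · rintro (_ | a)
    · simp [← h0, SameCycle.refl]
    · simp [SameCycle.refl]
  · intro y
    simp [SameCycle.refl]

lemma cycleCount_optionCongr [Finite X] (τ : Perm X) :
    cycleCount (τ.optionCongr : Perm (Option X)) = cycleCount τ + 1 := by
  set σ : Perm (Option X) := τ.optionCongr with hσ
  have hn : ∀ a : X, ¬ σ.SameCycle none (some a) := by
    intro a h
    have : σ none = none := by simp [hσ]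
    have := (SameCycle.eq_of_left h this)
    simp at this
  rw [cycleCount, cycleCount]
  rw [← Finite.card_option]
  let s : Setoid X := ⟨τ.SameCycle, SameCycle.equivalence τ⟩
  let t : Setoid (Option X) := ⟨σ.SameCycle, SameCycle.equivalence σ⟩
  have key : ∀ a b : X, σ.SameCycle (some a) (some b) ↔ τ.SameCycle a b := by
    intro a b
    constructor
    · intro h
      refine SameCycle.map_of_step (σ := σ) (τ := τ) (fun x => x.getD a) ?_ h
      rintro (_ | c) <;> simp [hσ, SameCycle.refl]
    · refine SameCycle.map_of_step some ?_
      intro c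
      have : σ (some c) = some (τ c) := by simp [hσ]
      rw [← this]
      simp [SameCycle.refl]
  symm
  refine Nat.card_eq_of_bijective
    (fun o : Option (Quotient s) => (o.elim (Quotient.mk t none)
      (Quotient.map some fun a b h => (key a b).2 h))) ⟨?_, ?_⟩
  · rintro (_ | a) (_ | b) h
    · rfl
    · induction b using Quotient.ind with | _ b
      exact absurd (Quotient.exact (s := t) h) (hn b)
    · induction a using Quotient.ind with | _ a
      exact absurd (Quotient.exact (s := t) h.symm) (hn a)
    · induction a, b using Quotient.ind₂ with | _ a b
      exact congrArg some (Quotient.sound ((key a b).1 (Quotient.exact (s := t) h)))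
  · rintro ⟨_ | a⟩
    · exact ⟨none, rfl⟩
    · exact ⟨some (Quotient.mk s a), rfl⟩

end CycleCount

section CyclePermanent

open Equiv Equiv.Perm

variable {X Y : Type*} [Fintype X] [DecidableEq X] [Fintype Y] [DecidableEq Y]

/-- The `α`-permanent of a square matrix: permutations are weighted by `α` per cycle. -/
noncomputable def cyclePermanent (α : ℚ) (M : X → X → ℚ) : ℚ :=
  ∑ σ : Perm X, α ^ cycleCount σ * ∏ a, M a (σ a)

lemma cyclePermanent_congr (α : ℚ) (e : X ≃ Y) {M : X → X → ℚ} {N : Y → Y → ℚ}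
    (h : ∀ a b, M a b = N (e a) (e b)) : cyclePermanent α M = cyclePermanent α N := by
  refine Fintype.sum_equiv e.permCongr _ _ fun σ => ?_
  rw [cycleCount_permCongr]
  congr 1
  refine Fintype.prod_equiv e _ _ fun a => ?_
  simp [h]

lemma cyclePermanent_option (α : ℚ) (M : Option X → Option X → ℚ) :
    cyclePermanent α M = α * M none none * cyclePermanent α (fun a b => M (some a) (some b)) +
      ∑ j, M none (some j) *
        cyclePermanent α (fun a b => if b = j then M (some a) none else M (some a) (some b)) := by
  rw [cyclePermanent, ← decomposeOption.symm.sum_comp, Fintype.sum_prod_type, Fintype.sum_option]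
  congr 1
  · rw [cyclePermanent, Finset.mul_sum]
    refine Finset.sum_congr rfl fun τ _ => ?_
    have : decomposeOption.symm (none, τ) = τ.optionCongr := by simp [← Equiv.Perm.one_def]
    rw [this, cycleCount_optionCongr, Fintype.prod_option]
    simp
    ring
  · refine Finset.sum_congr rfl fun j _ => ?_
    rw [cyclePermanent, Finset.mul_sum]
    refine Finset.sum_congr rfl fun τ _ => ?_
    have : decomposeOption.symm (some j, τ) = swap none (some j) * τ.optionCongr := by simp
    rw [this, cycleCount_swap_mul_optionCongr, Fintype.prod_option]
    have h1 : ∀ a, M (some a) ((swap none (some j) * τ.optionCongr : Perm (Option X)) (some a)) =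
        if τ a = j then M (some a) none else M (some a) (some (τ a)) := by
      intro a
      split_ifs with h
      · simp [h]
      · simp only [mul_apply, optionCongr_apply, Option.map_some]
        rw [swap_apply_of_ne_of_ne (by simp) (by simpa using h)]
    simp only [h1]
    simp
    ring

/-- If the column `none` agrees with every column that the row `none` charges, then removing
`none` multiplies the `α`-permanent by the weighted row sum. -/
lemma cyclePermanent_option_of_col (α : ℚ) (M : Option X → Option X → ℚ)
    (h : ∀ a j, M none (some j) ≠ 0 → M (some a) none = M (some a) (some j)) :
    cyclePermanent α M = (α * M none none + ∑ j, M none (some j)) *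
      cyclePermanent α (fun a b => M (some a) (some b)) := by
  rw [cyclePermanent_option, add_mul, Finset.sum_mul]
  congr 1
  refine Finset.sum_congr rfl fun j _ => ?_
  by_cases hj : M none (some j) = 0
  · simp [hj]
  congr 2
  funext a b
  split_ifs with hb
  · rw [hb, h a j hj]
  · rfl

lemma cyclePermanent_option_row_sub (α : ℚ) (M N L : Option X → Option X → ℚ)
    (hN : ∀ a b, N (some a) b = M (some a) b) (hL : ∀ a b, L (some a) b = M (some a) b)
    (h : ∀ b, M none b = N none b - L none b) :
    cyclePermanent α M = cyclePermanent α N - cyclePermanent α L := by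
  simp only [cyclePermanent_option, hN, hL, h, sub_mul, mul_sub, Finset.sum_sub_distrib]
  ring

end CyclePermanent

section DPermutationMatrix

/-- The weighted matrix whose `α`-permanent counts D-permutations, bordered by `k` rows and
columns of ones. The index `a : Fin i` stands for the integer `a + 1`, every bordering index
counts as larger than all of these, and even fixed points carry the weight `(α - 1) / α`. -/
noncomputable def dMatrix (α : ℚ) (i k : ℕ) : Fin i ⊕ Fin k → Fin i ⊕ Fin k → ℚ
  | .inl a, .inl b =>
    if a = b then (if Even (a + 1 : ℕ) then (α - 1) / α else 1)
    else if Even (a + 1 : ℕ) then (if b < a then 1 else 0) else (if a < b then 1 else 0)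
  | .inl a, .inr _ => if Even (a + 1 : ℕ) then 0 else 1
  | .inr _, _ => 1

/-- The equivalence adding `none` as the last element of the left summand. -/
def optionSumFinLeft (i k : ℕ) : Option (Fin i ⊕ Fin k) ≃ Fin (i + 1) ⊕ Fin k where
  toFun
    | none => .inl (Fin.last i)
    | some (.inl a) => .inl a.castSucc
    | some (.inr b) => .inr b
  invFun
    | .inl a => Fin.lastCases none (fun a => some (.inl a)) a
    | .inr b => some (.inr b)
  left_inv := by rintro (_ | _ | _) <;> simp
  right_inv := by
    rintro (a | b)
    · induction a using Fin.lastCases <;> simp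
    · simp

/-- The equivalence adding `none` as the last element of the right summand. -/
def optionSumFinRight (i k : ℕ) : Option (Fin i ⊕ Fin k) ≃ Fin i ⊕ Fin (k + 1) where
  toFun
    | none => .inr (Fin.last k)
    | some (.inl a) => .inl a
    | some (.inr b) => .inr b.castSucc
  invFun
    | .inl a => some (.inl a)
    | .inr b => Fin.lastCases none (fun b => some (.inr b)) b
  left_inv := by rintro (_ | _ | _) <;> simp
  right_inv := by
    rintro (a | b)
    · simp
    · induction b using Fin.lastCases <;> simp

variable (α : ℚ) (i k : ℕ)

/-- `dMatrix α (i + 1) k` with its last row replaced by `r`. -/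
noncomputable def dMatrixRow (r : Option (Fin i ⊕ Fin k) → ℚ) :
    Option (Fin i ⊕ Fin k) → Option (Fin i ⊕ Fin k) → ℚ
  | none, b => r b
  | some a, b => dMatrix α (i + 1) k (optionSumFinLeft i k (some a)) (optionSumFinLeft i k b)

lemma dMatrix_succ_left_some_some (a b : Fin i ⊕ Fin k) :
    dMatrix α (i + 1) k (optionSumFinLeft i k (some a)) (optionSumFinLeft i k (some b)) =
      dMatrix α i k a b := by
  rcases a with a | a <;> rcases b with b | b <;> simp [optionSumFinLeft, dMatrix]

lemma cyclePermanent_dMatrixRow_full :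
    cyclePermanent α (dMatrixRow α i k fun _ => 1) = cyclePermanent α (dMatrix α i (k + 1)) := by
  refine cyclePermanent_congr α (optionSumFinRight i k) ?_
  rintro (_ | a | a) (_ | b | b) <;>
    simp [optionSumFinLeft, optionSumFinRight, dMatrixRow, dMatrix, Fin.castSucc_lt_last,
      (Fin.castSucc_lt_last _).ne, (Fin.castSucc_lt_last _).not_gt]

/-- The last row of `dMatrix α (i + 1) k` for odd `i + 1`, with diagonal entry `d`. -/
def upperRow (d : ℚ) : Option (Fin i ⊕ Fin k) → ℚ
  | none => d
  | some (.inl _) => 0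
  | some (.inr _) => 1

lemma cyclePermanent_dMatrixRow_upper (d : ℚ) :
    cyclePermanent α (dMatrixRow α i k (upperRow i k d)) =
      (α * d + k) * cyclePermanent α (dMatrix α i k) := by
  rw [cyclePermanent_option_of_col]
  · congr 1
    · simp [dMatrixRow, upperRow]
    · congr 1
      funext a b
      exact dMatrix_succ_left_some_some α i k a b
  · rintro (a | a) (j | j) <;>
      simp [optionSumFinLeft, dMatrixRow, dMatrix, upperRow, Fin.castSucc_lt_last,
        (Fin.castSucc_lt_last _).ne, (Fin.castSucc_lt_last _).not_gt]

lemma cyclePermanent_dMatrix_succ_left :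
    cyclePermanent α (dMatrix α (i + 1) k) = cyclePermanent α
      (dMatrixRow α i k fun b => dMatrix α (i + 1) k (.inl (Fin.last i))
        (optionSumFinLeft i k b)) := by
  symm
  refine cyclePermanent_congr α (optionSumFinLeft i k) ?_
  rintro (_ | a) b <;> rfl

variable {i} in
lemma cyclePermanent_dMatrix_odd (hi : ¬ Even (i + 1)) :
    cyclePermanent α (dMatrix α (i + 1) k) = (α + k) * cyclePermanent α (dMatrix α i k) := by
  rw [cyclePermanent_dMatrix_succ_left]
  convert cyclePermanent_dMatrixRow_upper α i k 1 using 3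
  · funext b
    rcases b with _ | b | b <;>
    simp [optionSumFinLeft, dMatrix, upperRow, hi, (Fin.castSucc_lt_last _).ne',
      (Fin.castSucc_lt_last _).not_gt]
  · ring

variable {α i} in
lemma cyclePermanent_dMatrix_even (hα : α ≠ 0) (hi : Even (i + 1)) :
    cyclePermanent α (dMatrix α (i + 1) k) = cyclePermanent α (dMatrix α i (k + 1)) -
      (k + 1) * cyclePermanent α (dMatrix α i k) := by
  rw [cyclePermanent_dMatrix_succ_left, ← cyclePermanent_dMatrixRow_full,
    cyclePermanent_option_row_sub α
      (dMatrixRow α i k fun b => dMatrix α (i + 1) k (.inl (Fin.last i)) (optionSumFinLeft i k b))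
      (dMatrixRow α i k fun _ => 1)
      (dMatrixRow α i k (upperRow i k α⁻¹)) (fun _ _ => rfl) (fun _ _ => rfl),
    cyclePermanent_dMatrixRow_upper, mul_inv_cancel₀ hα, add_comm (1 : ℚ)]
  rintro (_ | b | b) <;>
    simp [optionSumFinLeft, dMatrix, dMatrixRow, upperRow, hi, (Fin.castSucc_lt_last _).ne',
      Fin.castSucc_lt_last]
  field_simp

lemma cyclePermanent_dMatrix_zero_succ :
    cyclePermanent α (dMatrix α 0 (k + 1)) = (α + k) * cyclePermanent α (dMatrix α 0 k) := by
  rw [← cyclePermanent_dMatrixRow_full]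
  have : (fun _ => 1) = upperRow 0 k 1 := by
    funext b
    rcases b with _ | b | b
    · rfl
    · exact b.elim0
    · rfl
  rw [this, cyclePermanent_dMatrixRow_upper, mul_one]

lemma cyclePermanent_dMatrix_zero_zero : cyclePermanent α (dMatrix α 0 0) = 1 := by
  have : Subsingleton (Equiv.Perm (Fin 0 ⊕ Fin 0)) := inferInstance
  simp [cyclePermanent, cycleCount]

end DPermutationMatrix

section Colorings

/-- `IsFerrersColoring S c`: the colouring `c` of the integers `1, …, i` (with `a : Fin i`
standing for `a + 1`) is proper for the Ferrers graph and avoids `S` at odd integers. -/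
def IsFerrersColoring {C : Type*} {i : ℕ} (S : Finset C) (c : Fin i → C) : Prop :=
  (∀ a b : Fin i, a < b → ¬ Even (a + 1 : ℕ) → Even (b + 1 : ℕ) → c a ≠ c b) ∧
    ∀ a : Fin i, ¬ Even (a + 1 : ℕ) → c a ∉ S

/-- The number of colourings of `1, …, i` counted by `IsFerrersColoring` when `q` colours are
available and `k` of them are forbidden at odd integers. -/
def coloringCount (q : ℤ) : ℕ → ℕ → ℤ
  | 0, _ => 1
  | i + 1, k =>
    if Even (i + 1) then k * coloringCount q i k + (q - k) * coloringCount q i (k + 1)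
    else (q - k) * coloringCount q i k

variable {C : Type*} {i : ℕ}

lemma isFerrersColoring_snoc_even [DecidableEq C] (hi : Even (i + 1)) (S : Finset C) (x : C)
    (c : Fin i → C) :
    IsFerrersColoring S (Fin.snoc c x : Fin (i + 1) → C) ↔ IsFerrersColoring (insert x S) c := by
  simp only [IsFerrersColoring, Fin.forall_fin_succ']
  simp [hi, Fin.castSucc_lt_last, (Fin.castSucc_lt_last _).not_gt]
  grind

lemma isFerrersColoring_snoc_odd (hi : ¬ Even (i + 1)) (S : Finset C) (x : C) (c : Fin i → C) :
    IsFerrersColoring S (Fin.snoc c x : Fin (i + 1) → C) ↔ x ∉ S ∧ IsFerrersColoring S c := by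
  simp only [IsFerrersColoring, Fin.forall_fin_succ']
  simp [hi, (Fin.castSucc_lt_last _).not_gt]
  grind

lemma sum_isFerrersColoring [Fintype C] (S : Finset C) :
    ∑ c : Fin i → C, (if IsFerrersColoring S c then (1 : ℤ) else 0) =
      coloringCount (Fintype.card C) i S.card := by
  induction i generalizing S with
  | zero => simp [IsFerrersColoring, coloringCount]
  | succ i ih =>
    rw [← (Fin.snocEquiv fun _ => C).sum_comp, Fintype.sum_prod_type, coloringCount]
    have hS : (S.card : ℤ) + Sᶜ.card = Fintype.card C := by
      exact_mod_cast S.card_add_card_compl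
    split_ifs with hi
    · have h (x : C) : ∑ c : Fin i → C, (if IsFerrersColoring S
          (Fin.snocEquiv (fun _ => C) (x, c)) then (1 : ℤ) else 0) =
          coloringCount (Fintype.card C) i (insert x S).card := by
        rw [← ih]
        simp [Fin.snocEquiv, isFerrersColoring_snoc_even hi]
      simp only [h]
      rw [← Finset.sum_add_sum_compl S,
        Finset.sum_congr rfl fun x hx => by rw [Finset.insert_eq_of_mem hx],
        Finset.sum_congr (s₁ := Sᶜ) rfl fun x hx => by
          rw [Finset.card_insert_of_notMem (Finset.mem_compl.1 hx)]]
      simp [← hS]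
    · have h (x : C) : ∑ c : Fin i → C, (if IsFerrersColoring S
          (Fin.snocEquiv (fun _ => C) (x, c)) then (1 : ℤ) else 0) =
          if x ∉ S then coloringCount (Fintype.card C) i S.card else 0 := by
        rw [← ih]
        split_ifs with hx <;> simp [Fin.snocEquiv, isFerrersColoring_snoc_odd hi, hx]
      simp only [h]
      rw [← Finset.sum_filter, Finset.filter_not, Finset.filter_mem_eq_inter,
        Finset.univ_inter, ← Finset.compl_eq_univ_sdiff]
      simp [← hS]

lemma cyclePermanent_dMatrix_eq {q : ℤ} (hq : q ≠ 1) (i k : ℕ) :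
    cyclePermanent (1 - q) (dMatrix (1 - q) i k) =
      (-1) ^ i * (∏ j ∈ Finset.range k, (1 - q + j : ℚ)) * coloringCount q i (k + 1) := by
  induction i generalizing k with
  | zero =>
    induction k with
    | zero => simp [cyclePermanent_dMatrix_zero_zero, coloringCount]
    | succ k ih =>
      rw [cyclePermanent_dMatrix_zero_succ, ih, Finset.prod_range_succ]
      simp [coloringCount]
      ring
  | succ i ih =>
    rw [coloringCount]
    split_ifs with hi
    · have : (1 - q : ℚ) ≠ 0 := sub_ne_zero.2 (by exact_mod_cast hq.symm)
      rw [cyclePermanent_dMatrix_even k this hi, ih, ih, Finset.prod_range_succ]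
      push_cast
      ring
    · rw [cyclePermanent_dMatrix_odd _ k hi, ih]
      push_cast
      ring

end Colorings

section BondLattice

variable {V : Finset ℕ} {C : Type*}

lemma Finpartition.le_iff_forall_mem_part {P Q : Finpartition V} :
    P ≤ Q ↔ ∀ a, ∀ b ∈ P.part a, b ∈ Q.part a := by
  constructor
  · intro h a b hb
    by_cases ha : a ∈ V
    · obtain ⟨t, ht, hPt⟩ := h (P.part_mem.2 ha)
      rw [Q.part_eq_of_mem ht (hPt (P.mem_part ha))]
      exact hPt hb
    · simp [P.part_eq_empty.2 ha] at hb
  · intro h B hB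
    obtain ⟨a, ha⟩ := P.nonempty_of_mem_parts hB
    refine ⟨Q.part a, Q.part_mem.2 (P.le hB ha), fun b hb => h a b ?_⟩
    rwa [P.part_eq_of_mem hB ha]

lemma ferrers_adj_mem {u v : ℕ} (h : (ferrers V).Adj u v) : u ∈ V ∧ v ∈ V := by
  rw [ferrers, SimpleGraph.fromRel_adj] at h
  tauto

/-- The subgraph of the Ferrers graph formed by the monochromatic edges of a colouring. -/
def monochromaticGraph (c : V → C) : SimpleGraph ℕ where
  Adj u v := (ferrers V).Adj u v ∧ ∀ hu hv, c ⟨u, hu⟩ = c ⟨v, hv⟩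
  symm := ⟨fun _ _ h => ⟨h.1.symm, fun hu hv => (h.2 hv hu).symm⟩⟩
  loopless := ⟨fun _ h => h.1.ne rfl⟩

/-- The partition of the vertices into the monochromatic components of a colouring. -/
noncomputable def monochromaticPartition (c : V → C) : Finpartition V :=
  Finpartition.ofSetSetoid (monochromaticGraph c).reachableSetoid V

lemma mem_part_monochromaticPartition {c : V → C} {a b : ℕ} :
    b ∈ (monochromaticPartition c).part a ↔
      a ∈ V ∧ b ∈ V ∧ (monochromaticGraph c).Reachable a b :=
  Finpartition.mem_part_ofSetSetoid_iff_rel V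

lemma isBond_monochromaticPartition (c : V → C) : IsBond V (monochromaticPartition c) := by
  intro B hB
  obtain ⟨a, ha⟩ := (monochromaticPartition c).nonempty_of_mem_parts hB
  have hB' : ∀ b, b ∈ B ↔ a ∈ V ∧ b ∈ V ∧ (monochromaticGraph c).Reachable a b := fun b => by
    rw [← mem_part_monochromaticPartition, Finpartition.part_eq_of_mem _ hB ha]
  rw [SimpleGraph.connected_iff_exists_forall_reachable]
  refine ⟨⟨a, ha⟩, fun ⟨b, hb⟩ => ?_⟩
  have h : ∀ b, (monochromaticGraph c).Reachable a b → ∃ hb : b ∈ B,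
      ((ferrers V).induce (B : Set ℕ)).Reachable ⟨a, ha⟩ ⟨b, hb⟩ := by
    intro b hab
    rw [SimpleGraph.reachable_iff_reflTransGen] at hab
    induction hab with
    | refl => exact ⟨ha, SimpleGraph.Reachable.refl _⟩
    | tail _ huv ih =>
      obtain ⟨hu, hau⟩ := ih
      have hv := (hB' _).2 ⟨((hB' _).1 hu).1, (ferrers_adj_mem huv.1).2,
        ((hB' _).1 hu).2.2.trans (SimpleGraph.Adj.reachable huv)⟩
      exact ⟨hv, hau.trans (SimpleGraph.Adj.reachable
        (SimpleGraph.induce_adj.2 huv.1))⟩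
  exact (h b ((hB' b).1 hb).2.2).2

lemma isBond_bot_s12 : IsBond V ⊥ := by
  intro B hB
  obtain ⟨a, -, rfl⟩ := Finpartition.mem_bot_iff.1 hB
  rw [SimpleGraph.connected_iff_exists_forall_reachable]
  refine ⟨⟨a, by simp⟩, fun ⟨b, hb⟩ => ?_⟩
  obtain rfl : b = a := by simpa using hb
  exact SimpleGraph.Reachable.refl _

lemma eq_of_reachable_monochromaticGraph {c : V → C} {a b : ℕ} (ha : a ∈ V)
    (h : (monochromaticGraph c).Reachable a b) : ∃ hb : b ∈ V, c ⟨a, ha⟩ = c ⟨b, hb⟩ := by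
  rw [SimpleGraph.reachable_iff_reflTransGen] at h
  induction h with
  | refl => exact ⟨ha, rfl⟩
  | tail _ huv ih =>
    obtain ⟨hu, hau⟩ := ih
    have hv := (ferrers_adj_mem huv.1).2
    exact ⟨hv, hau.trans (huv.2 hu hv)⟩

lemma le_monochromaticPartition_iff {P : Finpartition V} (hP : IsBond V P) {c : V → C} :
    P ≤ monochromaticPartition c ↔ ∀ a b : V, P.part a = P.part b → c a = c b := by
  rw [Finpartition.le_iff_forall_mem_part]
  constructor
  · intro h a b hab
    have hb : (b : ℕ) ∈ P.part a := hab ▸ P.mem_part b.2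
    obtain ⟨-, -, hr⟩ := mem_part_monochromaticPartition.1 (h a b hb)
    exact (eq_of_reachable_monochromaticGraph a.2 hr).2
  · intro h a b hb
    have ha : a ∈ V := by
      by_contra ha
      simp [P.part_eq_empty.2 ha] at hb
    have hB := P.part_mem.2 ha
    refine mem_part_monochromaticPartition.2 ⟨ha, P.le hB hb, ?_⟩
    have hr := (hP _ hB).preconnected ⟨a, P.mem_part ha⟩ ⟨b, hb⟩
    refine hr.map (⟨Subtype.val, fun {u v} huv => ⟨huv, fun hu hv => h ⟨u, hu⟩ ⟨v, hv⟩ ?_⟩⟩ :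
      (ferrers V).induce (P.part a : Set ℕ) →g monochromaticGraph c)
    rw [P.part_eq_of_mem hB u.2, P.part_eq_of_mem hB v.2]

lemma monochromaticPartition_eq_bot_iff {c : V → C} :
    monochromaticPartition c = ⊥ ↔ ∀ u v : V, (ferrers V).Adj u v → c u ≠ c v := by
  rw [← le_bot_iff, Finpartition.le_iff_forall_mem_part]
  have hbot : ∀ a b, b ∈ (⊥ : Finpartition V).part a ↔ a ∈ V ∧ b = a := fun a b => by
    by_cases ha : a ∈ V
    · rw [Finpartition.part_eq_of_mem (t := {a}) _ (Finpartition.mem_bot_iff.2 ⟨a, ha, rfl⟩)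
        (by simp)]
      simp [ha]
    · simp [(⊥ : Finpartition V).part_eq_empty.2 ha, ha]
  simp only [mem_part_monochromaticPartition, hbot]
  constructor
  · intro h u v huv hc
    exact huv.ne' (h u v ⟨u.2, v.2, SimpleGraph.Adj.reachable ⟨huv, fun _ _ => hc⟩⟩).2
  · rintro h a b ⟨ha, hb, hr⟩
    refine ⟨ha, ?_⟩
    rw [SimpleGraph.reachable_iff_reflTransGen] at hr
    rcases hr.cases_head with rfl | ⟨d, had, -⟩
    · rfl
    · have hd := (ferrers_adj_mem had.1).2
      exact absurd (had.2 ha hd) (h ⟨a, ha⟩ ⟨d, hd⟩ had.1)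

lemma card_colorings_constant_on_parts [Fintype C] (P : Finpartition V) :
    Fintype.card {c : V → C // ∀ a b : V, P.part a = P.part b → c a = c b} =
      Fintype.card C ^ P.parts.card := by
  have hne (B : P.parts) : ∃ a : V, P.part a = B := by
    obtain ⟨a, ha⟩ := P.nonempty_of_mem_parts B.2
    exact ⟨⟨a, P.le B.2 ha⟩, P.part_eq_of_mem B.2 ha⟩
  choose r hr using hne
  rw [← Fintype.card_coe, ← Fintype.card_fun]
  exact Fintype.card_congr
    { toFun := fun c B => c.1 (r B)
      invFun := fun f => ⟨fun a => f ⟨P.part a, P.part_mem.2 a.2⟩, fun a b h => by simp only [h]⟩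
      left_inv := fun c => Subtype.ext (funext fun a => c.2 _ _ (hr _))
      right_inv := fun f => funext fun B => congrArg f (Subtype.ext (hr B)) }

/-- Rota's formula: the characteristic polynomial of the bond lattice counts proper colourings. -/
lemma sum_mobius_mul_pow_eq [Fintype C] (m : Finpartition V → ℤ)
    (hm : ∀ Q, IsBond V Q →
      ∑ P with IsBond V P ∧ P ≤ Q, m P = if ⊥ = Q then 1 else 0) :
    ∑ P with IsBond V P, m P * (Fintype.card C : ℤ) ^ P.parts.card =
      ∑ c : V → C, if ∀ u v : V, (ferrers V).Adj u v → c u ≠ c v then 1 else 0 := by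
  have h1 (P : Finpartition V) (hP : IsBond V P) :
      m P * (Fintype.card C : ℤ) ^ P.parts.card =
        ∑ c : V → C, if P ≤ monochromaticPartition c then m P else 0 := by
    rw [← Finset.sum_filter, Finset.sum_const, nsmul_eq_mul, mul_comm]
    congr 1
    rw [← Nat.cast_pow, ← card_colorings_constant_on_parts P, Fintype.card_subtype]
    simp only [le_monochromaticPartition_iff hP]
  rw [Finset.sum_congr rfl fun P hP => h1 P (Finset.mem_filter.1 hP).2, Finset.sum_comm]
  refine Finset.sum_congr rfl fun c _ => ?_
  rw [← Finset.sum_filter, Finset.filter_filter, hm _ (isBond_monochromaticPartition c)]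
  simp only [eq_comm (a := (⊥ : Finpartition V)), monochromaticPartition_eq_bot_iff]

end BondLattice

section Assembly

/-- The integers `1, …, m` indexed by `Fin m`. -/
def iccEquivFin (m : ℕ) : {x // x ∈ Finset.Icc 1 m} ≃ Fin m where
  toFun x := ⟨x - 1, by have := Finset.mem_Icc.1 x.2; omega⟩
  invFun a := ⟨a + 1, Finset.mem_Icc.2 (by omega)⟩
  left_inv x := by
    have := Finset.mem_Icc.1 x.2
    ext
    simp only
    omega
  right_inv a := by simp

@[simp]
lemma iccEquivFin_add_one {m : ℕ} (x : {x // x ∈ Finset.Icc 1 m}) :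
    (iccEquivFin m x + 1 : ℕ) = x := by
  have := Finset.mem_Icc.1 x.2
  simp only [iccEquivFin, Equiv.coe_fn_mk]
  omega

lemma iccEquivFin_lt_iff {m : ℕ} {x y : {x // x ∈ Finset.Icc 1 m}} :
    iccEquivFin m x < iccEquivFin m y ↔ (x : ℕ) < y := by
  rw [← iccEquivFin_add_one x, ← iccEquivFin_add_one y, Fin.lt_def]
  omega

lemma sum_proper_colorings_ferrers {C : Type*} [Fintype C] (m : ℕ) :
    (∑ c : {x // x ∈ Finset.Icc 1 m} → C,
      if ∀ u v : {x // x ∈ Finset.Icc 1 m}, (ferrers (Finset.Icc 1 m)).Adj u v → c u ≠ c v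
      then (1 : ℤ) else 0) =
      coloringCount (Fintype.card C) m 0 := by
  rw [← Finset.card_empty (α := C), ← sum_isFerrersColoring]
  refine Fintype.sum_equiv ((iccEquivFin m).arrowCongr (Equiv.refl C)) _ _ fun c => ?_
  refine if_congr ?_ rfl rfl
  have hc (u : {x // x ∈ Finset.Icc 1 m}) :
      (iccEquivFin m).arrowCongr (Equiv.refl C) c (iccEquivFin m u) = c u := by simp
  simp only [ferrers, SimpleGraph.fromRel_adj, ← Nat.not_even_iff_odd]
  constructor
  · refine fun h => ⟨fun a b hab ha hb => ?_, by simp⟩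
    obtain ⟨u, rfl⟩ := (iccEquivFin m).surjective a
    obtain ⟨v, rfl⟩ := (iccEquivFin m).surjective b
    rw [iccEquivFin_add_one] at ha hb
    rw [iccEquivFin_lt_iff] at hab
    rw [hc, hc]
    exact h u v ⟨hab.ne, Or.inl ⟨u.2, v.2, hab, ha, hb⟩⟩
  · rintro ⟨h, -⟩
    have key (u v : {x // x ∈ Finset.Icc 1 m}) (huv : (u : ℕ) < v) (hu : ¬ Even (u : ℕ))
        (hv : Even (v : ℕ)) : c u ≠ c v := by
      have := h (iccEquivFin m u) (iccEquivFin m v) (iccEquivFin_lt_iff.2 huv)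
      rw [iccEquivFin_add_one, iccEquivFin_add_one, hc, hc] at this
      exact this hu hv
    rintro u v ⟨-, ⟨-, -, huv, hu, hv⟩ | ⟨-, -, huv, hu, hv⟩⟩
    · exact key u v huv hu hv
    · exact (key v u huv hu hv).symm

lemma evenFixCount_le_cycleCount {A : Finset ℕ} (σ : Equiv.Perm {x // x ∈ A}) :
    evenFixCount σ ≤ cycleCount σ := by
  rw [evenFixCount, ← Fintype.card_coe, ← Nat.card_eq_fintype_card, cycleCount]
  refine Nat.card_le_card_of_injective (fun i => Quotient.mk _ i.1) fun i j h => ?_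
  have hi := (Finset.mem_filter.1 i.2).2.1
  exact Subtype.ext ((Quotient.exact h : σ.SameCycle i j).eq_of_left hi)

lemma sum_isDPerm_eq_cyclePermanent {α : ℚ} (hα : α ≠ 0) (m : ℕ) :
    ∑ σ with IsDPerm (Finset.Icc 1 m) σ,
        (α - 1) ^ evenFixCount σ * α ^ (cycleCount σ - evenFixCount σ) =
      cyclePermanent α (dMatrix α m 0) := by
  have h : cyclePermanent α (dMatrix α m 0) = cyclePermanent α
      fun a b : {x // x ∈ Finset.Icc 1 m} =>
        dMatrix α m 0 (.inl (iccEquivFin m a)) (.inl (iccEquivFin m b)) :=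
    (cyclePermanent_congr α ((iccEquivFin m).trans (Equiv.sumEmpty _ _).symm)
      fun a b => rfl).symm
  rw [h, cyclePermanent, Finset.sum_filter]
  refine Finset.sum_congr rfl fun σ _ => ?_
  simp only [dMatrix, iccEquivFin_add_one, iccEquivFin_lt_iff, (iccEquivFin m).injective.eq_iff]
  split_ifs with hσ
  · have (a : {x // x ∈ Finset.Icc 1 m}) :
        (if a = σ a then if Even (a : ℕ) then (α - 1) / α else 1
          else if Even (a : ℕ) then if (σ a : ℕ) < a then 1 else 0
          else if (a : ℕ) < σ a then 1 else 0) =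
        if σ a = a ∧ Even (a : ℕ) then (α - 1) / α else 1 := by
      have h1 := hσ a
      have h2 : a = σ a ↔ (a : ℕ) = σ a := Subtype.ext_iff
      have h3 : σ a = a ↔ (a : ℕ) = σ a := by rw [eq_comm, h2]
      simp only [h2, h3]
      rw [← Nat.not_even_iff_odd] at h1
      grind
    rw [Finset.prod_congr rfl fun a _ => this a, ← Finset.prod_filter, Finset.prod_const,
      ← evenFixCount, div_pow, pow_sub₀ _ hα (evenFixCount_le_cycleCount σ)]
    field_simp
  · obtain ⟨a, ha⟩ := not_forall.1 hσ
    rw [Finset.prod_eq_zero (Finset.mem_univ a), mul_zero]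
    have h2 : a = σ a ↔ (a : ℕ) = σ a := Subtype.ext_iff
    rw [← Nat.not_even_iff_odd] at ha
    simp only [h2]
    grind

end Assembly

open Polynomial in
/-- `χ_{2n}(t) = (t-1) Σ_{σ ∈ D_{2n-2}} (-t)^{e(σ)} (1-t)^{o(σ)}`, where `e(σ)` is the number
of even fixed points of `σ` and `o(σ)` the number of its other cycles.  Here `μ` is any
function satisfying the defining recurrence of the Möbius function of the bond lattice of
`Γ_{2n}`, and `χ_{2n}(t) = Σ_π μ(0̂,π) t^{b(π)-1}`. -/
theorem stmt12 (n : ℕ) (hn : 1 ≤ n)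
    (μ : Finpartition (Finset.Icc 1 (2 * n)) → Finpartition (Finset.Icc 1 (2 * n)) → ℤ)
    (hμ : ∀ a b : Finpartition (Finset.Icc 1 (2 * n)),
      IsBond (Finset.Icc 1 (2 * n)) a → IsBond (Finset.Icc 1 (2 * n)) b → a ≤ b →
      (∑ c ∈ Finset.univ.filter fun c => IsBond (Finset.Icc 1 (2 * n)) c ∧ a ≤ c ∧ c ≤ b,
        μ a c) = if a = b then 1 else 0) :
    (∑ P ∈ Finset.univ.filter
        fun P : Finpartition (Finset.Icc 1 (2 * n)) => IsBond (Finset.Icc 1 (2 * n)) P,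
        Polynomial.C (μ ⊥ P) * Polynomial.X ^ (P.parts.card - 1)) =
      (Polynomial.X - 1) *
        ∑ σ ∈ Finset.univ.filter
          fun σ : Equiv.Perm {x // x ∈ Finset.Icc 1 (2 * n - 2)} =>
            IsDPerm (Finset.Icc 1 (2 * n - 2)) σ,
          (-Polynomial.X : Polynomial ℤ) ^ evenFixCount σ *
            (1 - Polynomial.X) ^ (cycleCount σ - evenFixCount σ) := by
  refine Polynomial.eq_of_infinite_eval_eq _ _ ((Set.Ici_infinite (2 : ℤ)).mono fun q hq => ?_)
  have hq2 : 2 ≤ q := hq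
  obtain ⟨m, rfl⟩ : ∃ m, n = m + 1 := ⟨n - 1, by omega⟩
  have hcard : (Fintype.card (Fin q.toNat) : ℤ) = q := by
    rw [Fintype.card_fin, Int.toNat_of_nonneg (by omega)]
  have hχ : ∑ P with IsBond (Finset.Icc 1 (2 * (m + 1))) P, μ ⊥ P * q ^ P.parts.card =
      coloringCount q (2 * (m + 1)) 0 := by
    have := sum_mobius_mul_pow_eq (C := Fin q.toNat) (μ ⊥) fun Q hQ => by
      simpa using hμ ⊥ Q isBond_bot_s12 hQ bot_le
    rwa [hcard, sum_proper_colorings_ferrers, hcard] at this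
  have hcount : coloringCount q (2 * (m + 1)) 0 = q * ((q - 1) * coloringCount q (2 * m) 1) := by
    rw [show 2 * (m + 1) = 2 * m + 1 + 1 by ring, coloringCount, coloringCount,
      coloringCount]
    simp [parity_simps]
  have hD : ∑ σ with IsDPerm (Finset.Icc 1 (2 * m)) σ,
      (-q) ^ evenFixCount σ * (1 - q) ^ (cycleCount σ - evenFixCount σ) =
        coloringCount q (2 * m) 1 := by
    have hq1 : (1 - q : ℚ) ≠ 0 := sub_ne_zero.2 (by exact_mod_cast (show (1 : ℤ) ≠ q by omega))
    have := sum_isDPerm_eq_cyclePermanent hq1 (2 * m)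
    rw [cyclePermanent_dMatrix_eq (by omega), sub_sub_cancel_left] at this
    simp only [Finset.range_zero, Finset.prod_empty, even_two_mul, Even.neg_one_pow, one_mul,
      zero_add] at this
    exact_mod_cast this
  simp only [Set.mem_ofPred_eq, Polynomial.eval_finsetSum, Polynomial.eval_mul,
    Polynomial.eval_sub, Polynomial.eval_pow, Polynomial.eval_neg, Polynomial.eval_X,
    Polynomial.eval_C, Polynomial.eval_one]
  rw [show 2 * (m + 1) - 2 = 2 * m by omega, hD]
  refine mul_left_cancel₀ (show q ≠ 0 by omega) ?_
  rw [← hcount, ← hχ, Finset.mul_sum]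
  refine Finset.sum_congr rfl fun P _ => ?_
  have hP : 0 < P.parts.card := by
    exact Finset.card_pos.2 (P.parts_nonempty (Finset.nonempty_Icc.2 (by omega)).ne_empty)
  rw [mul_left_comm, ← pow_succ', Nat.sub_add_cancel hP]
end
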